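/- arXiv:math/0106018 — 3 statements merged into one kernel-verified Lean document; each statement's English description precedes it below -/
import Mathlib

section
/- Let L be a topological complex line bundle on X together with, for every (x₁,x₂) ∈ X^[2], a ℂ-linear isomorphism φ_{(x₁,x₂)} : L_{x₁} → L_{x₂}, such that the induced map ((x₁,x₂),v) ↦ φ_{(x₁,x₂)}(v) from {((x₁,x₂),v) : (x₁,x₂) ∈ X^[2], v ∈ L_{x₁}} to the total space of L is continuous, and such that the descent cocycle condition φ_{(x₂,x₃)} ∘ φ_{(x₁,x₂)} = φ_{(x₁,x₃)} holds for every (x₁,x₂,x₃) ∈ X^[3]. Then L descends to M: there exist a topological complex line bundle Q on M and ℂ-linear isomorphisms ψ_x : L_x → Q_{π(x)} for each x ∈ X, with ((x),v) ↦ ψ_x(v) continuous in the same sense, which are compatible with φ, i.e. ψ_{x₂} ∘ φ_{(x₁,x₂)} = ψ_{x₁} for all (x₁,x₂) ∈ X^[2]. -/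
universe u v

/-- A topological complex line bundle on a space `B`: a family of complex vector spaces
`(fiber b)_{b ∈ B}` whose total space carries a topology making it a topological vector
bundle over `B` with typical fibre `ℂ` (in particular each fibre is one-dimensional,
being isomorphic to `ℂ`). -/
structure TopComplexLineBundle (B : Type v) [TopologicalSpace B] where
  fiber : B → Type u
  [addCommGroup : ∀ b, AddCommGroup (fiber b)]
  [module : ∀ b, Module ℂ (fiber b)]
  [fiberTopology : ∀ b, TopologicalSpace (fiber b)]
  [totalTopology : TopologicalSpace (Bundle.TotalSpace ℂ fiber)]
  [fiberBundle : FiberBundle ℂ fiber]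
  [vectorBundle : VectorBundle ℂ ℂ fiber]

attribute [instance] TopComplexLineBundle.addCommGroup TopComplexLineBundle.module
  TopComplexLineBundle.fiberTopology TopComplexLineBundle.totalTopology
  TopComplexLineBundle.fiberBundle TopComplexLineBundle.vectorBundle

open Bundle in
/-- A descent datum on a complex line bundle `L` along a map `p : X → M`: a continuous family of
linear isomorphisms between the fibres over points with the same image, satisfying the cocycle
condition. -/
structure LineBundleDescentDatum {X : Type v} {M : Type v} [TopologicalSpace X]
    (p : X → M) (L : X → Type u) [∀ x, AddCommGroup (L x)] [∀ x, Module ℂ (L x)]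
    [TopologicalSpace (TotalSpace ℂ L)] where
  iso : ∀ x₁ x₂ : X, p x₁ = p x₂ → (L x₁ ≃ₗ[ℂ] L x₂)
  continuous_iso : Continuous fun q : { q : TotalSpace ℂ L × X // p q.1.proj = p q.2 } =>
    (TotalSpace.mk q.1.2 (iso q.1.1.proj q.1.2 q.2 q.1.1.snd) : TotalSpace ℂ L)
  cocycle : ∀ (x₁ x₂ x₃ : X) (h₁₂ : p x₁ = p x₂) (h₂₃ : p x₂ = p x₃) (v : L x₁),
    iso x₂ x₃ h₂₃ (iso x₁ x₂ h₁₂ v) = iso x₁ x₃ (h₁₂.trans h₂₃) v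

open Bundle in
/-- A chart for the descended bundle: a section of `p`, continuous on an open set `baseSet` which
it maps into the base set of a trivialization of `L`. -/
structure LineBundleDescentChart {X : Type v} {M : Type v} [TopologicalSpace X]
    [TopologicalSpace M] (p : X → M) (L : X → Type u) [∀ x, AddCommGroup (L x)]
    [∀ x, Module ℂ (L x)] [∀ x, TopologicalSpace (L x)] [TopologicalSpace (TotalSpace ℂ L)]
    [FiberBundle ℂ L] where
  sec : M → X
  map_sec : ∀ m, p (sec m) = m
  triv : Trivialization ℂ (TotalSpace.proj : TotalSpace ℂ L → X)
  mem_atlas : MemTrivializationAtlas triv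
  baseSet : Set M
  isOpen_baseSet : IsOpen baseSet
  continuousOn_sec : ContinuousOn sec baseSet
  mapsTo_sec : Set.MapsTo sec baseSet triv.baseSet

namespace LineBundleDescentDatum

open Bundle Set Topology

variable {X : Type v} {M : Type v} [TopologicalSpace X] {p : X → M} {L : X → Type u}
  [∀ x, AddCommGroup (L x)] [∀ x, Module ℂ (L x)] [TopologicalSpace (TotalSpace ℂ L)]
  (D : LineBundleDescentDatum p L)

theorem iso_self (x : X) (v : L x) : D.iso x x rfl v = v :=
  (D.iso x x rfl).injective (D.cocycle x x x rfl rfl v)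

theorem iso_iso_symm (x y : X) (h : p x = p y) (v : L x) :
    D.iso y x h.symm (D.iso x y h v) = v := by
  rw [D.cocycle, D.iso_self]

theorem continuousOn_iso {Y : Type*} [TopologicalSpace Y] {s : Set Y} {f : Y → TotalSpace ℂ L}
    {g : Y → X} (hf : ContinuousOn f s) (hg : ContinuousOn g s)
    (h : ∀ y, p (f y).proj = p (g y)) :
    ContinuousOn (fun y => (TotalSpace.mk (g y) (D.iso (f y).proj (g y) (h y) (f y).snd) :
      TotalSpace ℂ L)) s :=
  D.continuous_iso.comp_continuousOn
    (f := fun y => (⟨(f y, g y), h y⟩ : { q : TotalSpace ℂ L × X // p q.1.proj = p q.2 }))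
    (IsInducing.subtypeVal.continuousOn_iff.2 (hf.prodMk hg))

variable [∀ x, TopologicalSpace (L x)] [FiberBundle ℂ L]

theorem continuous_iso_fiber (x y : X) (h : p x = p y) : Continuous (D.iso x y h) := by
  rw [(FiberBundle.totalSpaceMk_isInducing ℂ L y).continuous_iff]
  exact D.continuous_iso.comp
    (((FiberBundle.continuous_totalSpaceMk ℂ L x).prodMk continuous_const).subtype_mk fun _ => h)

/-- The isomorphisms of a descent datum are homeomorphisms. -/
def isoHomeomorph (x y : X) (h : p x = p y) : L x ≃ₜ L y where
  toFun := D.iso x y h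
  invFun := D.iso y x h.symm
  left_inv v := D.iso_iso_symm x y h v
  right_inv v := D.iso_iso_symm y x h.symm v
  continuous_toFun := D.continuous_iso_fiber x y h
  continuous_invFun := D.continuous_iso_fiber y x h.symm

variable [TopologicalSpace M] (c c' : LineBundleDescentChart p L)
  {σ : M → X} (hσ : ∀ m, p (σ m) = m)

/-- The pretrivialization of the descended bundle `m ↦ L (σ m)` given by a chart. -/
noncomputable def pretrivialization :
    Pretrivialization ℂ (TotalSpace.proj : TotalSpace ℂ (fun m => L (σ m)) → M) where
  toFun q := (q.1, (c.triv ⟨c.sec q.1,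
    D.iso (σ q.1) (c.sec q.1) ((hσ q.1).trans (c.map_sec q.1).symm) q.2⟩).2)
  invFun q := ⟨q.1, D.iso (c.sec q.1) (σ q.1) ((c.map_sec q.1).trans (hσ q.1).symm)
    (c.triv.symm (c.sec q.1) q.2)⟩
  source := TotalSpace.proj ⁻¹' c.baseSet
  target := c.baseSet ×ˢ univ
  map_source' q hq := ⟨hq, mem_univ _⟩
  map_target' q hq := hq.1
  left_inv' := by
    rintro ⟨m, v⟩ hm
    simp only
    rw [c.triv.symm_apply_apply_mk (c.mapsTo_sec hm), D.iso_iso_symm]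
  right_inv' := by
    rintro ⟨m, z⟩ hm
    simp only
    rw [D.iso_iso_symm, c.triv.apply_mk_symm (c.mapsTo_sec hm.1)]
  open_target := c.isOpen_baseSet.prod isOpen_univ
  baseSet := c.baseSet
  open_baseSet := c.isOpen_baseSet
  source_eq := rfl
  target_eq := rfl
  proj_toFun _ _ := rfl

theorem pretrivialization_apply (m : M) (v : L (σ m)) :
    D.pretrivialization c hσ ⟨m, v⟩ = (m, (c.triv ⟨c.sec m,
      D.iso (σ m) (c.sec m) ((hσ m).trans (c.map_sec m).symm) v⟩).2) :=
  rfl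

theorem pretrivialization_symm_apply {m : M} (hm : m ∈ c.baseSet) (z : ℂ) :
    (D.pretrivialization c hσ).symm m z =
      D.iso (c.sec m) (σ m) ((c.map_sec m).trans (hσ m).symm) (c.triv.symm (c.sec m) z) :=
  (D.pretrivialization c hσ).symm_apply hm z

/-- The transition function between the pretrivializations of two charts. -/
noncomputable def transition (m : M) : ℂ :=
  (c'.triv ⟨c'.sec m, D.iso (c.sec m) (c'.sec m) ((c.map_sec m).trans (c'.map_sec m).symm)
    (c.triv.symm (c.sec m) 1)⟩).2

theorem continuousOn_transition :
    ContinuousOn (D.transition c c') (c.baseSet ∩ c'.baseSet) := by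
  have hf : ContinuousOn
      (fun m => (⟨c.sec m, c.triv.symm (c.sec m) 1⟩ : TotalSpace ℂ L))
      (c.baseSet ∩ c'.baseSet) :=
    c.triv.continuousOn_symm.comp
      (((c.continuousOn_sec.mono inter_subset_left).prodMk continuousOn_const))
      fun m hm => ⟨c.mapsTo_sec hm.1, mem_univ _⟩
  have hg := D.continuousOn_iso hf (c'.continuousOn_sec.mono inter_subset_right)
    fun m => (c.map_sec m).trans (c'.map_sec m).symm
  exact continuous_snd.comp_continuousOn (c'.triv.continuousOn.comp hg fun m hm =>
    c'.triv.mem_source.2 (c'.mapsTo_sec hm.2))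

variable [VectorBundle ℂ ℂ L]

theorem pretrivialization_isLinear : (D.pretrivialization c hσ).IsLinear ℂ where
  linear m hm := by
    have := c.mem_atlas
    have h := c.triv.linear ℂ (c.mapsTo_sec hm)
    constructor
    · intro v w
      simp only [pretrivialization_apply, map_add]
      exact h.map_add _ _
    · intro a v
      simp only [pretrivialization_apply, map_smul]
      exact h.map_smul _ _

theorem smul_transition {m : M} (hm : m ∈ c.baseSet ∩ c'.baseSet) (z : ℂ) :
    z • D.transition c c' m =
      (D.pretrivialization c' hσ ⟨m, (D.pretrivialization c hσ).symm m z⟩).2 := by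
  have := c.mem_atlas
  have := c'.mem_atlas
  have h := c'.triv.linear ℂ (c'.mapsTo_sec hm.2)
  rw [pretrivialization_apply, pretrivialization_symm_apply _ _ _ hm.1, D.cocycle, transition,
    ← h.map_smul, ← map_smul]
  have : c.triv.symm (c.sec m) z = z • c.triv.symm (c.sec m) 1 := by
    rw [← c.triv.symmL_apply (R := ℂ) (c.mapsTo_sec hm.1),
      ← c.triv.symmL_apply (R := ℂ) (c.mapsTo_sec hm.1), ← map_smul, smul_eq_mul, mul_one]
  rw [this]

theorem isInducing_pretrivialization_mk {m : M} (hm : m ∈ c.baseSet) :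
    IsInducing (D.pretrivialization c hσ ∘ TotalSpace.mk m) := by
  have := c.mem_atlas
  exact (isEmbedding_prodMkRight m).isInducing.comp
    ((c.triv.continuousLinearEquivAt ℂ (c.sec m)
      (c.mapsTo_sec hm)).toHomeomorph.isInducing.comp
      (D.isoHomeomorph (σ m) (c.sec m) ((hσ m).trans (c.map_sec m).symm)).isInducing)

/-- The descended bundle, presented by the pretrivializations of a family of charts. -/
noncomputable def vectorPrebundle (chartAt : M → LineBundleDescentChart p L)
    (hchart : ∀ m, m ∈ (chartAt m).baseSet) : VectorPrebundle ℂ ℂ (fun m => L (σ m)) where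
  pretrivializationAtlas := range fun m => D.pretrivialization (chartAt m) hσ
  pretrivialization_linear' := by
    rintro _ ⟨m, rfl⟩
    exact D.pretrivialization_isLinear _ hσ
  pretrivializationAt m := D.pretrivialization (chartAt m) hσ
  mem_base_pretrivializationAt := hchart
  pretrivialization_mem_atlas m := mem_range_self m
  exists_coordChange := by
    rintro _ ⟨m, rfl⟩ _ ⟨m', rfl⟩
    exact ⟨fun b => ContinuousLinearMap.toSpanSingleton ℂ (D.transition (chartAt m) (chartAt m') b),
      (ContinuousLinearMap.toSpanSingletonCLE (𝕜 := ℂ) (E := ℂ)).continuous.comp_continuousOn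
        (D.continuousOn_transition _ _),
      fun b hb v => D.smul_transition _ _ hσ hb v⟩
  totalSpaceMk_isInducing m := D.isInducing_pretrivialization_mk _ hσ (hchart m)

theorem continuous_toDescended (hp : Continuous p) (chartAt : M → LineBundleDescentChart p L)
    (hchart : ∀ m, m ∈ (chartAt m).baseSet) :
    letI := (D.vectorPrebundle hσ chartAt hchart).totalSpaceTopology
    Continuous fun q : TotalSpace ℂ L =>
      (⟨p q.proj, D.iso q.proj (σ (p q.proj)) (hσ _).symm q.snd⟩ :
        TotalSpace ℂ (fun m => L (σ m))) := by
  let := (D.vectorPrebundle hσ chartAt hchart).totalSpaceTopology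
  let := (D.vectorPrebundle hσ chartAt hchart).toFiberBundle
  have hproj : Continuous fun q : TotalSpace ℂ L => p q.proj :=
    hp.comp (FiberBundle.continuous_proj ℂ L)
  refine continuous_iff_continuousAt.2 fun q₀ =>
    (FiberBundle.continuousAt_totalSpace ℂ _).2 ⟨hproj.continuousAt, ?_⟩
  set c := chartAt (p q₀.proj)
  change ContinuousAt (fun q : TotalSpace ℂ L => (D.pretrivialization c hσ
    ⟨p q.proj, D.iso q.proj (σ (p q.proj)) (hσ _).symm q.snd⟩).2) q₀
  simp only [pretrivialization_apply, D.cocycle]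
  have hg := D.continuousOn_iso continuousOn_id
    (c.continuousOn_sec.comp hproj.continuousOn fun _ hq => hq) fun q => (c.map_sec _).symm
  exact (continuous_snd.comp_continuousOn (c.triv.continuousOn.comp hg fun q hq =>
    c.triv.mem_source.2 (c.mapsTo_sec hq))).continuousAt
      ((c.isOpen_baseSet.preimage hproj).mem_nhds (hchart _))

end LineBundleDescentDatum

open Bundle in
theorem LineBundleDescentChart.exists_mem_baseSet {X : Type v} {M : Type v} [TopologicalSpace X]
    [TopologicalSpace M] {p : X → M} (hsurj : Function.Surjective p)
    (hsec : ∀ m : M, ∃ U : Set M, IsOpen U ∧ m ∈ U ∧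
      ∃ s : U → X, Continuous s ∧ ∀ u : U, p (s u) = (u : M))
    (L : X → Type u) [∀ x, AddCommGroup (L x)]
    [∀ x, Module ℂ (L x)] [∀ x, TopologicalSpace (L x)] [TopologicalSpace (TotalSpace ℂ L)]
    [FiberBundle ℂ L] (m : M) :
    ∃ c : LineBundleDescentChart p L, m ∈ c.baseSet := by
  classical
  obtain ⟨U, hU, hm, s, hs, hps⟩ := hsec m
  let t : M → X := fun b => if h : b ∈ U then s ⟨b, h⟩ else Function.surjInv hsurj b
  have ht : ContinuousOn t U := by
    rw [continuousOn_iff_continuous_domRestrict]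
    convert hs using 1
    ext u
    simp [t]
  let e := trivializationAt ℂ L (t m)
  refine ⟨⟨t, fun b => ?_, e, inferInstance, U ∩ t ⁻¹' e.baseSet,
    ht.isOpen_inter_preimage hU e.open_baseSet, ht.mono Set.inter_subset_left, fun _ h => h.2⟩,
    hm, FiberBundle.mem_baseSet_trivializationAt' (t m)⟩
  by_cases h : b ∈ U
  · simp [t, h, hps]
  · simp [t, h, Function.surjInv_eq]

/-- descent of complex line bundles along a surjection admitting local
sections.  Given a line bundle `L` on `X` and a continuous family of fibrewise linear
isomorphisms `φ_{(x₁,x₂)} : L_{x₁} → L_{x₂}` for `(x₁,x₂) ∈ X^[2]` satisfying the descent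
cocycle condition over `X^[3]`, the bundle `L` descends to a line bundle `Q` on `M`,
together with compatible linear isomorphisms `ψ_x : L_x → Q_{π(x)}` depending continuously
on `(x,v)`. -/
theorem line_bundle_descent {X : Type v} {M : Type v}
    [TopologicalSpace X] [TopologicalSpace M]
    (π : X → M) (hπ : Continuous π) (hsurj : Function.Surjective π)
    (hsec : ∀ m : M, ∃ U : Set M, IsOpen U ∧ m ∈ U ∧
      ∃ s : U → X, Continuous s ∧ ∀ u : U, π (s u) = (u : M))
    (L : X → Type u) [∀ x, AddCommGroup (L x)] [∀ x, Module ℂ (L x)]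
    [∀ x, TopologicalSpace (L x)] [TopologicalSpace (Bundle.TotalSpace ℂ L)]
    [FiberBundle ℂ L] [VectorBundle ℂ ℂ L]
    (φ : ∀ x₁ x₂ : X, π x₁ = π x₂ → (L x₁ ≃ₗ[ℂ] L x₂))
    (hφcont : Continuous fun p : { p : Bundle.TotalSpace ℂ L × X // π p.1.proj = π p.2 } =>
      (Bundle.TotalSpace.mk p.1.2 (φ p.1.1.proj p.1.2 p.2 p.1.1.snd) :
        Bundle.TotalSpace ℂ L))
    (hcocycle : ∀ (x₁ x₂ x₃ : X) (h₁₂ : π x₁ = π x₂) (h₂₃ : π x₂ = π x₃) (v : L x₁),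
      φ x₂ x₃ h₂₃ (φ x₁ x₂ h₁₂ v) = φ x₁ x₃ (h₁₂.trans h₂₃) v) :
    ∃ (Q : TopComplexLineBundle.{u} M) (ψ : ∀ x : X, L x ≃ₗ[ℂ] Q.fiber (π x)),
      (Continuous fun p : Bundle.TotalSpace ℂ L =>
        (Bundle.TotalSpace.mk (π p.proj) (ψ p.proj p.snd) :
          Bundle.TotalSpace ℂ Q.fiber)) ∧
      ∀ (x₁ x₂ : X) (h : π x₁ = π x₂) (v : L x₁),
        ψ x₂ (φ x₁ x₂ h v) = cast (congrArg Q.fiber h) (ψ x₁ v) := by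
  let D : LineBundleDescentDatum π L := ⟨φ, hφcont, hcocycle⟩
  choose chartAt hchart using LineBundleDescentChart.exists_mem_baseSet hsurj hsec L
  let σ : M → X := Function.surjInv hsurj
  have hσ : ∀ m, π (σ m) = m := Function.surjInv_eq hsurj
  let Z := D.vectorPrebundle hσ chartAt hchart
  let := Z.totalSpaceTopology
  let := Z.toFiberBundle
  have := Z.toVectorBundle
  refine ⟨⟨fun m => L (σ m)⟩, fun x => φ x (σ (π x)) (hσ _).symm,
    D.continuous_toDescended hσ hπ chartAt hchart, fun x₁ x₂ h v => ?_⟩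
  rw [hcocycle]
  have key : ∀ (m : M) (hm : π x₁ = m), φ x₁ (σ m) (hm.trans (hσ m).symm) v =
      cast (congrArg (fun m => L (σ m)) hm) (φ x₁ (σ (π x₁)) (hσ _).symm v) := by
    rintro _ rfl
    rfl
  exact key _ h
end

section
/- The pentagon (associativity coherence) holds for the homotopy bigroupoid of a topological space X: for paths γ₁₂ from x₁ to x₂, γ₂₃ from x₂ to x₃, γ₃₄ from x₃ to x₄ and γ₄₅ from x₄ to x₅, the vertical composite, in order, of the 2-tracks [ā(γ₄₅,γ₃₄,γ₂₃) ∘ c_{γ₁₂}], then [ā(γ₄₅, γ₃₄ ∘ γ₂₃, γ₁₂)], then [c_{γ₄₅} ∘ ā(γ₃₄,γ₂₃,γ₁₂)] equals the vertical composite of [ā(γ₄₅ ∘ γ₃₄, γ₂₃, γ₁₂)] then [ā(γ₄₅, γ₃₄, γ₂₃ ∘ γ₁₂)], as 2-tracks from ((γ₄₅ ∘ γ₃₄) ∘ γ₂₃) ∘ γ₁₂ to γ₄₅ ∘ (γ₃₄ ∘ (γ₂₃ ∘ γ₁₂)). Equivalently, the composite 2-arrow around the pentagon of associator 2-tracks is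 the identity 2-track. -/
namespace BundleTwoGerbe

open Set

variable {X : Type*} [TopologicalSpace X]

/-- `γ : [0,1] → X` is a path from `x₁` to `x₂` (as a function on `ℝ`, continuous on `[0,1]`). -/
noncomputable def IsPath (x₁ x₂ : X) (γ : ℝ → X) : Prop :=
  ContinuousOn γ (Icc 0 1) ∧ γ 0 = x₁ ∧ γ 1 = x₂

/-- The composite path `γ₂₃ ∘ γ₁₂`: `t ↦ γ₁₂(2t)` for `t ∈ [0,1/2]`, `t ↦ γ₂₃(2t−1)` for
`t ∈ [1/2,1]`. -/
noncomputable def pathComp (γ₂₃ γ₁₂ : ℝ → X) : ℝ → X :=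
  fun t => if t ≤ 1 / 2 then γ₁₂ (2 * t) else γ₂₃ (2 * t - 1)

/-- The constant path `1ₓ` at `x`. -/
noncomputable def constPath (x : X) : ℝ → X := fun _ => x

/-- `μ : [0,1]² → X` is a homotopy (with endpoints fixed) from `γ₁` to `γ₂`, where `γ₁, γ₂`
are paths from `x₁` to `x₂`:  `μ(0,t) = γ₁(t)`, `μ(1,t) = γ₂(t)`, `μ(s,0) = x₁`, `μ(s,1) = x₂`. -/
noncomputable def IsHomotopy (x₁ x₂ : X) (γ₁ γ₂ : ℝ → X) (μ : ℝ → ℝ → X) : Prop :=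
  ContinuousOn (fun p : ℝ × ℝ => μ p.1 p.2) (Icc 0 1 ×ˢ Icc 0 1) ∧
    (∀ t ∈ Icc (0 : ℝ) 1, μ 0 t = γ₁ t) ∧
    (∀ t ∈ Icc (0 : ℝ) 1, μ 1 t = γ₂ t) ∧
    (∀ s ∈ Icc (0 : ℝ) 1, μ s 0 = x₁) ∧
    (∀ s ∈ Icc (0 : ℝ) 1, μ s 1 = x₂)

/-- Two homotopies `μ, μ'` from `γ₁` to `γ₂` (paths from `x₁` to `x₂`) are equivalent:
there is a continuous `H : [0,1]³ → X` with `H(0,s,t) = μ(s,t)`, `H(1,s,t) = μ′(s,t)`,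
`H(r,0,t) = γ₁(t)`, `H(r,1,t) = γ₂(t)`, `H(r,s,0) = x₁` and `H(r,s,1) = x₂`. -/
noncomputable def HomotopyEquiv (x₁ x₂ : X) (γ₁ γ₂ : ℝ → X) (μ μ' : ℝ → ℝ → X) : Prop :=
  ∃ H : ℝ → ℝ → ℝ → X,
    ContinuousOn (fun p : ℝ × ℝ × ℝ => H p.1 p.2.1 p.2.2)
      (Icc 0 1 ×ˢ Icc 0 1 ×ˢ Icc 0 1) ∧
    (∀ s ∈ Icc (0 : ℝ) 1, ∀ t ∈ Icc (0 : ℝ) 1, H 0 s t = μ s t) ∧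
    (∀ s ∈ Icc (0 : ℝ) 1, ∀ t ∈ Icc (0 : ℝ) 1, H 1 s t = μ' s t) ∧
    (∀ r ∈ Icc (0 : ℝ) 1, ∀ t ∈ Icc (0 : ℝ) 1, H r 0 t = γ₁ t) ∧
    (∀ r ∈ Icc (0 : ℝ) 1, ∀ t ∈ Icc (0 : ℝ) 1, H r 1 t = γ₂ t) ∧
    (∀ r ∈ Icc (0 : ℝ) 1, ∀ s ∈ Icc (0 : ℝ) 1, H r s 0 = x₁) ∧
    (∀ r ∈ Icc (0 : ℝ) 1, ∀ s ∈ Icc (0 : ℝ) 1, H r s 1 = x₂)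

/-- The vertical composite `λμ` of homotopies: `(λμ)(s,t) = μ(2s,t)` for `s ∈ [0,1/2]` and
`λ(2s−1,t)` for `s ∈ [1/2,1]`. -/
noncomputable def vcomp (lam mu : ℝ → ℝ → X) : ℝ → ℝ → X :=
  fun s t => if s ≤ 1 / 2 then mu (2 * s) t else lam (2 * s - 1) t

/-- The horizontal composite `μ₂₃ ∘ μ₁₂` of homotopies:
`(μ₂₃ ∘ μ₁₂)(s,t) = μ₁₂(s,2t)` for `t ∈ [0,1/2]` and `μ₂₃(s,2t−1)` for `t ∈ [1/2,1]`. -/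
noncomputable def hcomp (μ₂₃ μ₁₂ : ℝ → ℝ → X) : ℝ → ℝ → X :=
  fun s t => if t ≤ 1 / 2 then μ₁₂ s (2 * t) else μ₂₃ s (2 * t - 1)

/-- The constant homotopy `c_γ(s,t) = γ(t)` from `γ` to itself. -/
noncomputable def constHomotopy (γ : ℝ → X) : ℝ → ℝ → X := fun _ t => γ t

/-- The associator map `ā(γ₃₄,γ₂₃,γ₁₂) : [0,1]² → X`. -/
noncomputable def associator (γ₃₄ γ₂₃ γ₁₂ : ℝ → X) : ℝ → ℝ → X :=
  fun s t =>
    if t ≤ (2 - s) / 4 then γ₁₂ (4 * t / (2 - s))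
    else if t ≤ (3 - s) / 4 then γ₂₃ (4 * t - 2 + s)
    else γ₃₄ ((4 * t - 3 + s) / (1 + s))

/-- The left identity map `L(γ) : [0,1]² → X`, for `γ` a path starting at `x₁`. -/
noncomputable def leftUnitor (x₁ : X) (γ : ℝ → X) : ℝ → ℝ → X :=
  fun s t => if t ≤ s / 2 then x₁ else γ ((2 * t - s) / (2 - s))

/-- The right identity map `R(γ) : [0,1]² → X`, for `γ` a path ending at `x₂`. -/
noncomputable def rightUnitor (x₂ : X) (γ : ℝ → X) : ℝ → ℝ → X :=
  fun s t => if t ≤ 1 / (s + 1) then γ ((s + 1) * t) else x₂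

theorem continuousOn_ite_le {Y : Type*} [TopologicalSpace Y] {S : Set Y} (hS : IsClosed S)
    {f g : Y → ℝ} (hf : Continuous f) (hg : Continuous g) {F G : Y → X}
    (hF : ContinuousOn F (S ∩ {y | f y ≤ g y})) (hG : ContinuousOn G (S ∩ {y | g y ≤ f y}))
    (h : ∀ y ∈ S, f y = g y → F y = G y) :
    ContinuousOn (fun y => if f y ≤ g y then F y else G y) S := by
  have hS' : S = (S ∩ {y | f y ≤ g y}) ∪ (S ∩ {y | g y ≤ f y}) := by
    ext y
    simp only [mem_union, mem_inter_iff, mem_ofPred_eq]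
    have := le_total (f y) (g y)
    tauto
  rw [hS']
  refine ContinuousOn.union_of_isClosed ?_ ?_ (hS.inter (isClosed_le hf hg))
    (hS.inter (isClosed_le hg hf))
  · exact hF.congr fun y hy => if_pos hy.2
  · refine hG.congr fun y hy => ?_
    by_cases hy' : f y ≤ g y
    · exact (if_pos hy').trans (h y hy.1 (le_antisymm hy' hy.2))
    · exact if_neg hy'

theorem isClosed_unitSquare : IsClosed (Icc (0 : ℝ) 1 ×ˢ Icc (0 : ℝ) 1) :=
  isClosed_Icc.prod isClosed_Icc

theorem IsPath.pathComp {a b c : X} {γ γ' : ℝ → X} (h' : IsPath b c γ') (h : IsPath a b γ) :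
    IsPath a c (pathComp γ' γ) := by
  obtain ⟨hc, h0, h1⟩ := h
  obtain ⟨hc', h0', h1'⟩ := h'
  refine ⟨?_, by simp [BundleTwoGerbe.pathComp, h0], ?_⟩
  · refine continuousOn_ite_le isClosed_Icc continuous_id continuous_const ?_ ?_ ?_
    · refine hc.comp (by fun_prop) ?_
      rintro t ⟨⟨h1, h2⟩, h3⟩
      simp only [mem_ofPred_eq, id] at h3
      constructor <;> linarith
    · refine hc'.comp (by fun_prop) ?_
      rintro t ⟨⟨h1, h2⟩, h3⟩
      simp only [mem_ofPred_eq, id] at h3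
      constructor <;> linarith
    · rintro t - ht
      simp only [id] at ht
      subst ht
      norm_num [h1, h0']
  · norm_num [BundleTwoGerbe.pathComp, h1']

theorem IsPath.isHomotopy_constHomotopy {a b : X} {γ : ℝ → X} (h : IsPath a b γ) :
    IsHomotopy a b γ γ (constHomotopy γ) :=
  ⟨h.1.comp (by fun_prop) fun _ hp => hp.2, fun _ _ => rfl, fun _ _ => rfl,
    fun _ _ => h.2.1, fun _ _ => h.2.2⟩

theorem IsHomotopy.vcomp {a b : X} {γ₁ γ₂ γ₃ : ℝ → X} {lam mu : ℝ → ℝ → X}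
    (hl : IsHomotopy a b γ₂ γ₃ lam) (hm : IsHomotopy a b γ₁ γ₂ mu) :
    IsHomotopy a b γ₁ γ₃ (vcomp lam mu) := by
  obtain ⟨hc, h0, h1, ha, hb⟩ := hm
  obtain ⟨hc', h0', h1', ha', hb'⟩ := hl
  refine ⟨?_, fun t ht => ?_, fun t ht => ?_, fun s hs => ?_, fun s hs => ?_⟩
  · refine continuousOn_ite_le isClosed_unitSquare continuous_fst continuous_const ?_ ?_ ?_
    · refine hc.comp (f := fun p : ℝ × ℝ => (2 * p.1, p.2)) (by fun_prop) ?_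
      rintro ⟨s, t⟩ ⟨⟨⟨h1, h2⟩, ht⟩, h3⟩
      simp only [mem_ofPred_eq] at h1 h2 h3
      exact ⟨⟨by simp only; linarith, by simp only; linarith⟩, ht⟩
    · refine hc'.comp (f := fun p : ℝ × ℝ => (2 * p.1 - 1, p.2)) (by fun_prop) ?_
      rintro ⟨s, t⟩ ⟨⟨⟨h1, h2⟩, ht⟩, h3⟩
      simp only [mem_ofPred_eq] at h1 h2 h3
      exact ⟨⟨by simp only; linarith, by simp only; linarith⟩, ht⟩
    · rintro ⟨s, t⟩ ⟨-, ht⟩ hs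
      simp only at hs ht
      subst hs
      norm_num [h1 t ht, h0' t ht]
  · simp [BundleTwoGerbe.vcomp, h0 t ht]
  · norm_num [BundleTwoGerbe.vcomp, h1' t ht]
  · simp only [BundleTwoGerbe.vcomp]
    split_ifs with h
    · exact ha _ ⟨by linarith [hs.1], by linarith⟩
    · exact ha' _ ⟨by linarith, by linarith [hs.2]⟩
  · simp only [BundleTwoGerbe.vcomp]
    split_ifs with h
    · exact hb _ ⟨by linarith [hs.1], by linarith⟩
    · exact hb' _ ⟨by linarith, by linarith [hs.2]⟩

theorem IsHomotopy.hcomp {a b c : X} {γ₁ γ₂ γ₁' γ₂' : ℝ → X} {μ μ' : ℝ → ℝ → X}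
    (h' : IsHomotopy b c γ₁' γ₂' μ') (h : IsHomotopy a b γ₁ γ₂ μ) :
    IsHomotopy a c (BundleTwoGerbe.pathComp γ₁' γ₁) (BundleTwoGerbe.pathComp γ₂' γ₂)
      (hcomp μ' μ) := by
  obtain ⟨hc, h0, h1, ha, hb⟩ := h
  obtain ⟨hc', h0', h1', ha', hb'⟩ := h'
  refine ⟨?_, fun t ht => ?_, fun t ht => ?_, fun s hs => ?_, fun s hs => ?_⟩
  · refine continuousOn_ite_le isClosed_unitSquare continuous_snd continuous_const ?_ ?_ ?_
    · refine hc.comp (f := fun p : ℝ × ℝ => (p.1, 2 * p.2)) (by fun_prop) ?_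
      rintro ⟨s, t⟩ ⟨⟨hs, ⟨h1, h2⟩⟩, h3⟩
      simp only [mem_ofPred_eq] at h1 h2 h3
      exact ⟨hs, ⟨by simp only; linarith, by simp only; linarith⟩⟩
    · refine hc'.comp (f := fun p : ℝ × ℝ => (p.1, 2 * p.2 - 1)) (by fun_prop) ?_
      rintro ⟨s, t⟩ ⟨⟨hs, ⟨h1, h2⟩⟩, h3⟩
      simp only [mem_ofPred_eq] at h1 h2 h3
      exact ⟨hs, ⟨by simp only; linarith, by simp only; linarith⟩⟩
    · rintro ⟨s, t⟩ ⟨hs, -⟩ ht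
      simp only at hs ht
      subst ht
      norm_num [hb s hs, ha' s hs]
  · simp only [BundleTwoGerbe.hcomp, BundleTwoGerbe.pathComp]
    split_ifs with h
    · exact h0 _ ⟨by linarith [ht.1], by linarith⟩
    · exact h0' _ ⟨by linarith, by linarith [ht.2]⟩
  · simp only [BundleTwoGerbe.hcomp, BundleTwoGerbe.pathComp]
    split_ifs with h
    · exact h1 _ ⟨by linarith [ht.1], by linarith⟩
    · exact h1' _ ⟨by linarith, by linarith [ht.2]⟩
  · simp [BundleTwoGerbe.hcomp, ha s hs]
  · norm_num [BundleTwoGerbe.hcomp, hb' s hs]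

section Domains

variable {s t : ℝ}

theorem associator_arg_left_mem (hs : s ∈ Icc (0 : ℝ) 1) (ht : t ∈ Icc (0 : ℝ) 1)
    (h : t ≤ (2 - s) / 4) : 4 * t / (2 - s) ∈ Icc (0 : ℝ) 1 := by
  obtain ⟨hs0, hs1⟩ := hs
  have h2 : 0 < 2 - s := by linarith
  exact ⟨div_nonneg (by linarith [ht.1]) h2.le, (div_le_one h2).2 (by linarith)⟩

theorem associator_arg_middle_mem (h : (2 - s) / 4 ≤ t) (h' : t ≤ (3 - s) / 4) :
    4 * t - 2 + s ∈ Icc (0 : ℝ) 1 :=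
  ⟨by linarith, by linarith⟩

theorem associator_arg_right_mem (hs : s ∈ Icc (0 : ℝ) 1) (ht : t ∈ Icc (0 : ℝ) 1)
    (h : (3 - s) / 4 ≤ t) : (4 * t - 3 + s) / (1 + s) ∈ Icc (0 : ℝ) 1 := by
  obtain ⟨hs0, hs1⟩ := hs
  have h2 : 0 < 1 + s := by linarith
  exact ⟨div_nonneg (by linarith) h2.le, (div_le_one h2).2 (by linarith [ht.2])⟩

end Domains

theorem isHomotopy_associator {a b c d : X} {γ₁ γ₂ γ₃ : ℝ → X}
    (h₃ : IsPath c d γ₃) (h₂ : IsPath b c γ₂) (h₁ : IsPath a b γ₁) :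
    IsHomotopy a d (pathComp (pathComp γ₃ γ₂) γ₁) (pathComp γ₃ (pathComp γ₂ γ₁))
      (associator γ₃ γ₂ γ₁) := by
  obtain ⟨hc₁, h₁0, h₁1⟩ := h₁
  obtain ⟨hc₂, h₂0, h₂1⟩ := h₂
  obtain ⟨hc₃, h₃0, h₃1⟩ := h₃
  refine ⟨?_, fun t ht => ?_, fun t ht => ?_, fun s hs => ?_, fun s hs => ?_⟩
  · have hlow : Continuous fun p : ℝ × ℝ => (2 - p.1) / 4 := by fun_prop
    have hhigh : Continuous fun p : ℝ × ℝ => (3 - p.1) / 4 := by fun_prop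
    refine continuousOn_ite_le isClosed_unitSquare continuous_snd hlow ?_ ?_ ?_
    · refine hc₁.comp (ContinuousOn.div (by fun_prop) (by fun_prop) ?_) ?_
      · rintro ⟨s, t⟩ ⟨⟨⟨-, hs⟩, -⟩, -⟩
        simp only at hs ⊢
        linarith
      · rintro ⟨s, t⟩ ⟨⟨hs, ht⟩, h⟩
        exact associator_arg_left_mem hs ht h
    · refine continuousOn_ite_le (isClosed_unitSquare.inter (isClosed_le hlow continuous_snd))
        continuous_snd hhigh ?_ ?_ ?_
      · refine hc₂.comp (by fun_prop) ?_
        rintro ⟨s, t⟩ ⟨⟨-, h⟩, h'⟩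
        exact associator_arg_middle_mem h h'
      · refine hc₃.comp (ContinuousOn.div (by fun_prop) (by fun_prop) ?_) ?_
        · rintro ⟨s, t⟩ ⟨⟨⟨⟨hs, -⟩, -⟩, -⟩, -⟩
          simp only at hs ⊢
          linarith
        · rintro ⟨s, t⟩ ⟨⟨⟨hs, ht⟩, -⟩, h⟩
          exact associator_arg_right_mem hs ht h
      · rintro ⟨s, t⟩ - h
        simp only at h ⊢
        subst h
        rw [show 4 * ((3 - s) / 4) - 2 + s = 1 by ring,
          show 4 * ((3 - s) / 4) - 3 + s = 0 by ring, zero_div, h₂1, h₃0]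
    · rintro ⟨s, t⟩ ⟨⟨-, hs⟩, -⟩ h
      simp only at h hs ⊢
      subst h
      have h2 : 2 - s ≠ 0 := by linarith
      rw [if_pos (by linarith), show 4 * ((2 - s) / 4) - 2 + s = 0 by ring,
        mul_div_cancel₀ _ (by norm_num : (4 : ℝ) ≠ 0), div_self h2, h₁1, h₂0]
  · simp only [associator, pathComp]
    split_ifs <;> first | (exfalso; linarith) | (congr 1; ring)
  · simp only [associator, pathComp]
    split_ifs <;> first | (exfalso; linarith) | (congr 1; ring)
  · have : (0 : ℝ) ≤ (2 - s) / 4 := by linarith [hs.2]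
    simp [associator, this, h₁0]
  · obtain ⟨hs0, hs1⟩ := hs
    have h1 : ¬ (1 : ℝ) ≤ (2 - s) / 4 := by linarith
    have h2 : ¬ (1 : ℝ) ≤ (3 - s) / 4 := by linarith
    have h3 : 1 + s ≠ 0 := by linarith
    simp only [associator, if_neg h1, if_neg h2]
    rw [show 4 * (1 : ℝ) - 3 + s = 1 + s by ring, div_self h3, h₃1]

section Lift

variable {Y Z : Type*} (σ : Y → Z)

/-- `γ` agrees with `σ ∘ e` on `[0,1]`. -/
def PathLift (γ : ℝ → Z) (e : ℝ → Y) : Prop :=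
  ∀ t ∈ Icc (0 : ℝ) 1, γ t = σ (e t)

/-- `μ` agrees with `σ ∘ m` on `[0,1]²`. -/
def HomotopyLift (μ : ℝ → ℝ → Z) (m : ℝ → ℝ → Y) : Prop :=
  ∀ s ∈ Icc (0 : ℝ) 1, ∀ t ∈ Icc (0 : ℝ) 1, μ s t = σ (m s t)

variable {σ}

theorem PathLift.pathComp {γ γ' : ℝ → Z} {e e' : ℝ → Y} (h' : PathLift σ γ' e')
    (h : PathLift σ γ e) : PathLift σ (pathComp γ' γ) (pathComp e' e) := by
  intro t ht
  simp only [BundleTwoGerbe.pathComp]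
  split_ifs with h1
  · exact h _ ⟨by linarith [ht.1], by linarith⟩
  · exact h' _ ⟨by linarith, by linarith [ht.2]⟩

theorem PathLift.constHomotopy {γ : ℝ → Z} {e : ℝ → Y} (h : PathLift σ γ e) :
    HomotopyLift σ (constHomotopy γ) (constHomotopy e) :=
  fun _ _ => h

theorem HomotopyLift.vcomp {μ μ' : ℝ → ℝ → Z} {m m' : ℝ → ℝ → Y} (h' : HomotopyLift σ μ' m')
    (h : HomotopyLift σ μ m) : HomotopyLift σ (vcomp μ' μ) (vcomp m' m) := by
  intro s hs t ht
  simp only [BundleTwoGerbe.vcomp]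
  split_ifs with h1
  · exact h _ ⟨by linarith [hs.1], by linarith⟩ t ht
  · exact h' _ ⟨by linarith, by linarith [hs.2]⟩ t ht

theorem HomotopyLift.hcomp {μ μ' : ℝ → ℝ → Z} {m m' : ℝ → ℝ → Y} (h' : HomotopyLift σ μ' m')
    (h : HomotopyLift σ μ m) : HomotopyLift σ (hcomp μ' μ) (hcomp m' m) := by
  intro s hs t ht
  simp only [BundleTwoGerbe.hcomp]
  split_ifs with h1
  · exact h s hs _ ⟨by linarith [ht.1], by linarith⟩
  · exact h' s hs _ ⟨by linarith, by linarith [ht.2]⟩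

theorem PathLift.associator {γ₁ γ₂ γ₃ : ℝ → Z} {e₁ e₂ e₃ : ℝ → Y} (h₃ : PathLift σ γ₃ e₃)
    (h₂ : PathLift σ γ₂ e₂) (h₁ : PathLift σ γ₁ e₁) :
    HomotopyLift σ (associator γ₃ γ₂ γ₁) (associator e₃ e₂ e₁) := by
  intro s hs t ht
  simp only [BundleTwoGerbe.associator]
  split_ifs with h h'
  · exact h₁ _ (associator_arg_left_mem hs ht h)
  · exact h₂ _ (associator_arg_middle_mem (not_le.1 h).le h')
  · exact h₃ _ (associator_arg_right_mem hs ht (not_le.1 h').le)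

theorem PathLift.congr_of_le {σ τ : ℝ → Z} {γ : ℝ → Z} {n m : ℝ} (hnm : n + 1 ≤ m)
    (h : PathLift σ γ fun t => t + n) (hτ : ∀ u ≤ m, τ u = σ u) :
    PathLift τ γ fun t => t + n :=
  fun t ht => (h t ht).trans (hτ _ (by linarith [ht.2])).symm

end Lift

/-- Any two homotopies that lift along a common continuous map from `ℝ`, with the same boundary
upstairs, are equivalent: interpolate linearly between the lifts. -/
theorem homotopyEquiv_of_lift {σ : ℝ → X} (hσ : Continuous σ) {a b : ℝ} {e₁ e₂ : ℝ → ℝ}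
    {m m' : ℝ → ℝ → ℝ} (hm : IsHomotopy a b e₁ e₂ m) (hm' : IsHomotopy a b e₁ e₂ m')
    {γ₁ γ₂ : ℝ → X} {μ μ' : ℝ → ℝ → X} (h₁ : PathLift σ γ₁ e₁) (h₂ : PathLift σ γ₂ e₂)
    (hμ : HomotopyLift σ μ m) (hμ' : HomotopyLift σ μ' m') :
    HomotopyEquiv (σ a) (σ b) γ₁ γ₂ μ μ' := by
  obtain ⟨hc, h0, h1, ha, hb⟩ := hm
  obtain ⟨hc', h0', h1', ha', hb'⟩ := hm'
  refine ⟨fun r s t => σ ((1 - r) * m s t + r * m' s t), ?_, fun s hs t ht => ?_,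
    fun s hs t ht => ?_, fun r _ t ht => ?_, fun r _ t ht => ?_, fun r _ s hs => ?_,
    fun r _ s hs => ?_⟩
  · have k : ContinuousOn (fun p : ℝ × ℝ × ℝ => m p.2.1 p.2.2)
        (Icc 0 1 ×ˢ Icc 0 1 ×ˢ Icc 0 1) :=
      hc.comp (f := fun p : ℝ × ℝ × ℝ => p.2) (by fun_prop) fun p hp => hp.2
    have k' : ContinuousOn (fun p : ℝ × ℝ × ℝ => m' p.2.1 p.2.2)
        (Icc 0 1 ×ˢ Icc 0 1 ×ˢ Icc 0 1) :=
      hc'.comp (f := fun p : ℝ × ℝ × ℝ => p.2) (by fun_prop) fun p hp => hp.2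
    exact hσ.comp_continuousOn (by fun_prop)
  · simp [hμ s hs t ht]
  · simp [hμ' s hs t ht]
  · simp only [h0 t ht, h0' t ht, h₁ t ht]
    congr 1
    ring
  · simp only [h1 t ht, h1' t ht, h₂ t ht]
    congr 1
    ring
  · simp only [ha s hs, ha' s hs]
    congr 1
    ring
  · simp only [hb s hs, hb' s hs]
    congr 1
    ring

theorem isPath_add_const (a : ℝ) : IsPath a (a + 1) fun t => t + a :=
  ⟨by fun_prop, zero_add a, add_comm 1 a⟩

/-- A path with junk values outside `[0,1]` agrees on `[0,1]` with a globally continuous map that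
is constant on each side. -/
theorem IsPath.exists_extension {a b : X} {γ : ℝ → X} (h : IsPath a b γ) :
    ∃ g : ℝ → X, Continuous g ∧ (∀ t ∈ Icc (0 : ℝ) 1, g t = γ t) ∧
      (∀ t ≤ 0, g t = a) ∧ ∀ t, 1 ≤ t → g t = b := by
  refine ⟨IccExtend zero_le_one ((Icc (0 : ℝ) 1).domRestrict γ),
    h.1.domRestrict.Icc_extend', fun t ht => IccExtend_of_mem _ _ ht, fun t ht => ?_, fun t ht => ?_⟩
  · rw [IccExtend_of_le_left _ _ ht]
    exact h.2.1
  · rw [IccExtend_of_right_le _ _ ht]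
    exact h.2.2

/-- Attaching a path of unit length at time `n` to a map that is already constant after time `n`. -/
theorem exists_extend_by_path {σ : ℝ → X} (hσ : Continuous σ) {n : ℝ} {b c : X}
    (hb : ∀ u, n ≤ u → σ u = b) {γ : ℝ → X} (h : IsPath b c γ) :
    ∃ τ : ℝ → X, Continuous τ ∧ (∀ u ≤ n, τ u = σ u) ∧ (PathLift τ γ fun t => t + n) ∧
      ∀ u, n + 1 ≤ u → τ u = c := by
  obtain ⟨g, hg, hgγ, hg0, hg1⟩ := h.exists_extension
  have hτ : ∀ u, n ≤ u → (if u ≤ n then σ u else g (u - n)) = g (u - n) := by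
    intro u hu
    split_ifs with hu'
    · rw [hb u hu, hg0 _ (by linarith)]
    · rfl
  refine ⟨fun u => if u ≤ n then σ u else g (u - n), ?_, fun u hu => if_pos hu, fun t ht => ?_,
    fun u hu => ?_⟩
  · refine Continuous.if_le hσ (by fun_prop) continuous_id continuous_const ?_
    rintro u rfl
    rw [hb _ le_rfl, hg0 _ (sub_self _).le]
  · simp only
    rw [hτ _ (by linarith [ht.1]), add_sub_cancel_right, hgγ t ht]
  · simp only
    rw [hτ u (by linarith), hg1 _ (by linarith)]

/-- the pentagon (associativity coherence) for the homotopy bigroupoid: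
the vertical composite, in order, of `[ā(γ₄₅,γ₃₄,γ₂₃) ∘ c_{γ₁₂}]`, then
`[ā(γ₄₅, γ₃₄ ∘ γ₂₃, γ₁₂)]`, then `[c_{γ₄₅} ∘ ā(γ₃₄,γ₂₃,γ₁₂)]` equals the vertical
composite of `[ā(γ₄₅ ∘ γ₃₄, γ₂₃, γ₁₂)]` then `[ā(γ₄₅, γ₃₄, γ₂₃ ∘ γ₁₂)]`. -/
theorem pentagon (x₁ x₂ x₃ x₄ x₅ : X) (γ₁₂ γ₂₃ γ₃₄ γ₄₅ : ℝ → X)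
    (h12 : IsPath x₁ x₂ γ₁₂) (h23 : IsPath x₂ x₃ γ₂₃)
    (h34 : IsPath x₃ x₄ γ₃₄) (h45 : IsPath x₄ x₅ γ₄₅) :
    HomotopyEquiv x₁ x₅
      (pathComp (pathComp (pathComp γ₄₅ γ₃₄) γ₂₃) γ₁₂)
      (pathComp γ₄₅ (pathComp γ₃₄ (pathComp γ₂₃ γ₁₂)))
      (vcomp (hcomp (constHomotopy γ₄₅) (associator γ₃₄ γ₂₃ γ₁₂))
        (vcomp (associator γ₄₅ (pathComp γ₃₄ γ₂₃) γ₁₂)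
          (hcomp (associator γ₄₅ γ₃₄ γ₂₃) (constHomotopy γ₁₂))))
      (vcomp (associator γ₄₅ γ₃₄ (pathComp γ₂₃ γ₁₂))
        (associator (pathComp γ₄₅ γ₃₄) γ₂₃ γ₁₂)) := by
  obtain ⟨σ₁, hσ₁, hz₁, l₁, hr₁⟩ :=
    exists_extend_by_path (continuous_const (y := x₁)) (n := 0) (fun _ _ => rfl) h12
  obtain ⟨σ₂, hσ₂, hz₂, l₂, hr₂⟩ := exists_extend_by_path hσ₁ hr₁ h23
  obtain ⟨σ₃, hσ₃, hz₃, l₃, hr₃⟩ := exists_extend_by_path hσ₂ hr₂ h34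
  obtain ⟨σ, hσ, hz, l₄, hr⟩ := exists_extend_by_path hσ₃ hr₃ h45
  replace l₃ := l₃.congr_of_le le_rfl hz
  replace l₂ := (l₂.congr_of_le le_rfl hz₃).congr_of_le (by linarith) hz
  replace l₁ := ((l₁.congr_of_le le_rfl hz₂).congr_of_le (by linarith) hz₃).congr_of_le
    (by linarith) hz
  have p₁ := isPath_add_const 0
  have p₂ := isPath_add_const (0 + 1)
  have p₃ := isPath_add_const (0 + 1 + 1)
  have p₄ := isPath_add_const (0 + 1 + 1 + 1)
  have hx₁ : σ 0 = x₁ := by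
    simpa [h12.2.1] using (l₁ 0 (left_mem_Icc.2 zero_le_one)).symm
  rw [← hx₁, ← hr _ le_rfl]
  exact homotopyEquiv_of_lift hσ
    ((p₄.isHomotopy_constHomotopy.hcomp (isHomotopy_associator p₃ p₂ p₁)).vcomp
      ((isHomotopy_associator p₄ (p₃.pathComp p₂) p₁).vcomp
        ((isHomotopy_associator p₄ p₃ p₂).hcomp p₁.isHomotopy_constHomotopy)))
    ((isHomotopy_associator p₄ p₃ (p₂.pathComp p₁)).vcomp
      (isHomotopy_associator (p₄.pathComp p₃) p₂ p₁))
    (((l₄.pathComp l₃).pathComp l₂).pathComp l₁)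
    (l₄.pathComp (l₃.pathComp (l₂.pathComp l₁)))
    ((l₄.constHomotopy.hcomp (l₃.associator l₂ l₁)).vcomp
      ((l₄.associator (l₃.pathComp l₂) l₁).vcomp
        ((l₄.associator l₃ l₂).hcomp l₁.constHomotopy)))
    ((l₄.associator l₃ (l₂.pathComp l₁)).vcomp ((l₄.pathComp l₃).associator l₂ l₁))

end BundleTwoGerbe
end

section
/- The triangle (identity coherence) holds for the homotopy bigroupoid of a topological space X: for paths α from x₁ to x₂ and β from x₂ to x₃, the vertical composite of the 2-track [L(β) ∘ c_α] (a 2-track from β ∘ α to (β ∘ 1_{x₂}) ∘ α) followed by the associator 2-track [ā(β, 1_{x₂}, α)] equals the 2-track [c_β ∘ R(α)] from β ∘ α to β ∘ (1_{x₂} ∘ α). -/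
namespace BundleTwoGerbe

open Set

variable {X : Type*} [TopologicalSpace X]

/-- Two reparametrizations of one path that agree on the sides `s = 0` and `s = 1` and are
constant on the sides `t = 0` and `t = 1` are equivalent, by affine interpolation. -/
theorem HomotopyEquiv.of_reparam {x₁ x₂ : X} {γ₁ γ₂ : ℝ → X} {μ μ' : ℝ → ℝ → X}
    {γ : ℝ → X} (hγ : Continuous γ) {f g : ℝ → ℝ → ℝ} {a b : ℝ}
    (hf : ContinuousOn (fun p : ℝ × ℝ => f p.1 p.2) (Icc 0 1 ×ˢ Icc 0 1))
    (hg : ContinuousOn (fun p : ℝ × ℝ => g p.1 p.2) (Icc 0 1 ×ˢ Icc 0 1))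
    (hμ : ∀ s ∈ Icc (0 : ℝ) 1, ∀ t ∈ Icc (0 : ℝ) 1, γ (f s t) = μ s t)
    (hμ' : ∀ s ∈ Icc (0 : ℝ) 1, ∀ t ∈ Icc (0 : ℝ) 1, γ (g s t) = μ' s t)
    (h₀ : ∀ t ∈ Icc (0 : ℝ) 1, f 0 t = g 0 t) (h₁ : ∀ t ∈ Icc (0 : ℝ) 1, f 1 t = g 1 t)
    (hγ₁ : ∀ t ∈ Icc (0 : ℝ) 1, γ (g 0 t) = γ₁ t)
    (hγ₂ : ∀ t ∈ Icc (0 : ℝ) 1, γ (g 1 t) = γ₂ t)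
    (hf₀ : ∀ s ∈ Icc (0 : ℝ) 1, f s 0 = a) (hg₀ : ∀ s ∈ Icc (0 : ℝ) 1, g s 0 = a)
    (hf₁ : ∀ s ∈ Icc (0 : ℝ) 1, f s 1 = b) (hg₁ : ∀ s ∈ Icc (0 : ℝ) 1, g s 1 = b)
    (ha : γ a = x₁) (hb : γ b = x₂) :
    HomotopyEquiv x₁ x₂ γ₁ γ₂ μ μ' := by
  have key : ∀ r u : ℝ, (1 - r) * u + r * u = u := fun r u => by ring
  refine ⟨fun r s t => γ ((1 - r) * f s t + r * g s t), ?_, ?_, ?_, ?_, ?_, ?_, ?_⟩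
  · have hmaps : MapsTo (fun p : ℝ × ℝ × ℝ => p.2)
        (Icc 0 1 ×ˢ Icc 0 1 ×ˢ Icc 0 1) (Icc 0 1 ×ˢ Icc 0 1) := fun p hp => hp.2
    have hf' := hf.comp continuous_snd.continuousOn hmaps
    have hg' := hg.comp continuous_snd.continuousOn hmaps
    have hr : ContinuousOn (fun p : ℝ × ℝ × ℝ => p.1)
      (Icc 0 1 ×ˢ Icc 0 1 ×ˢ Icc 0 1) := continuous_fst.continuousOn
    exact hγ.comp_continuousOn (((continuousOn_const.sub hr).mul hf').add (hr.mul hg'))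
  · intro s hs t ht
    simpa using hμ s hs t ht
  · intro s hs t ht
    simpa using hμ' s hs t ht
  · intro r _ t ht
    simp only [h₀ t ht, key, hγ₁ t ht]
  · intro r _ t ht
    simp only [h₁ t ht, key, hγ₂ t ht]
  · intro r _ s hs
    simp only [hf₀ s hs, hg₀ s hs, key, ha]
  · intro r _ s hs
    simp only [hf₁ s hs, hg₁ s hs, key, hb]

/-- The concatenation of two paths, traversed at unit speed on `[0,2]`, extends continuously
to `ℝ`. -/
theorem exists_continuous_concat {x₁ x₂ x₃ : X} {α β : ℝ → X}
    (hα : IsPath x₁ x₂ α) (hβ : IsPath x₂ x₃ β) :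
    ∃ γ : ℝ → X, Continuous γ ∧ (∀ u ∈ Icc (0 : ℝ) 1, γ u = α u) ∧
      ∀ u ∈ Icc (0 : ℝ) 1, γ (1 + u) = β u := by
  have hclamp : ∀ u : ℝ, max 0 (min u 1) ∈ Icc (0 : ℝ) 1 := fun u =>
    ⟨le_max_left _ _, max_le zero_le_one (min_le_right _ _)⟩
  have hα' : Continuous fun u : ℝ => α (max 0 (min u 1)) :=
    hα.1.comp_continuous (by fun_prop) hclamp
  have hβ' : Continuous fun u : ℝ => β (max 0 (min (u - 1) 1)) :=
    hβ.1.comp_continuous (by fun_prop) fun u => hclamp (u - 1)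
  refine ⟨fun u => if u ≤ 1 then α (max 0 (min u 1)) else β (max 0 (min (u - 1) 1)),
    hα'.if_le hβ' continuous_id continuous_const ?_, ?_, ?_⟩
  · rintro u rfl
    simp [hα.2.2, hβ.2.1]
  · rintro u ⟨h₀, h₁⟩
    simp [h₀, h₁]
  · rintro u ⟨h₀, h₁⟩
    rcases h₀.eq_or_lt with rfl | h₀
    · simp [hα.2.2, hβ.2.1]
    · simp [h₀.le, h₁, h₀]

/-- The parameter on the concatenation `[0,2]` traced by `leftUnitor β` after a constant
homotopy. -/
noncomputable def unitorParam (s t : ℝ) : ℝ :=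
  min (2 * t) 1 + max 0 ((2 * (2 * t - 1) - s) / (2 - s))

/-- The parameter on the concatenation `[0,2]` traced by the associator with constant middle
path. -/
noncomputable def associatorParam (s t : ℝ) : ℝ :=
  min (4 * t / (2 - s)) 1 + max 0 ((4 * t - 3 + s) / (1 + s))

theorem unitorParam_spec {Y : Type*} {x₂ : Y} {α β γ : ℝ → Y}
    (hα : ∀ u ∈ Icc (0 : ℝ) 1, γ u = α u) (hβ : ∀ u ∈ Icc (0 : ℝ) 1, γ (1 + u) = β u)
    (hx₂ : γ 1 = x₂) {s t : ℝ} (hs : s ∈ Icc (0 : ℝ) 1) (ht : t ∈ Icc (0 : ℝ) 1) :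
    γ (unitorParam s t) = hcomp (leftUnitor x₂ β) (constHomotopy α) s t := by
  obtain ⟨hs₀, hs₁⟩ := hs
  obtain ⟨ht₀, ht₁⟩ := ht
  have hd : 0 < 2 - s := by linarith
  unfold unitorParam hcomp leftUnitor constHomotopy
  split_ifs with h h'
  · rw [min_eq_left (by linarith),
      max_eq_left (div_nonpos_of_nonpos_of_nonneg (by linarith) hd.le), add_zero]
    exact hα _ ⟨by linarith, by linarith⟩
  · rw [min_eq_right (by linarith),
      max_eq_left (div_nonpos_of_nonpos_of_nonneg (by linarith) hd.le), add_zero, hx₂]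
  · rw [min_eq_right (by linarith), max_eq_right (div_nonneg (by linarith) hd.le)]
    exact hβ _ ⟨div_nonneg (by linarith) hd.le, (div_le_one hd).2 (by linarith)⟩

theorem associatorParam_spec {Y : Type*} {x₂ : Y} {α β γ : ℝ → Y}
    (hα : ∀ u ∈ Icc (0 : ℝ) 1, γ u = α u) (hβ : ∀ u ∈ Icc (0 : ℝ) 1, γ (1 + u) = β u)
    (hx₂ : γ 1 = x₂) {s t : ℝ} (hs : s ∈ Icc (0 : ℝ) 1) (ht : t ∈ Icc (0 : ℝ) 1) :
    γ (associatorParam s t) = associator β (constPath x₂) α s t := by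
  obtain ⟨hs₀, hs₁⟩ := hs
  obtain ⟨ht₀, ht₁⟩ := ht
  have hd : 0 < 2 - s := by linarith
  have hd' : 0 < 1 + s := by linarith
  unfold associatorParam associator constPath
  split_ifs with h h'
  · have h1 : 4 * t / (2 - s) ≤ 1 := (div_le_one hd).2 (by linarith)
    rw [min_eq_left h1,
      max_eq_left (div_nonpos_of_nonpos_of_nonneg (by linarith) hd'.le), add_zero]
    exact hα _ ⟨div_nonneg (by linarith) hd.le, h1⟩
  · rw [min_eq_right ((one_le_div hd).2 (by linarith)),
      max_eq_left (div_nonpos_of_nonpos_of_nonneg (by linarith) hd'.le), add_zero, hx₂]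
  · rw [min_eq_right ((one_le_div hd).2 (by linarith)),
      max_eq_right (div_nonneg (by linarith) hd'.le)]
    exact hβ _ ⟨div_nonneg (by linarith) hd'.le, (div_le_one hd').2 (by linarith)⟩

theorem rightUnitorParam_spec {Y : Type*} {x₂ : Y} {α β γ : ℝ → Y}
    (hα : ∀ u ∈ Icc (0 : ℝ) 1, γ u = α u) (hβ : ∀ u ∈ Icc (0 : ℝ) 1, γ (1 + u) = β u)
    (hx₂ : γ 1 = x₂) {s t : ℝ} (hs : s ∈ Icc (0 : ℝ) 1) (ht : t ∈ Icc (0 : ℝ) 1) :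
    γ (min ((s + 1) * (2 * t)) 1 + max 0 (2 * t - 1)) =
      hcomp (constHomotopy β) (rightUnitor x₂ α) s t := by
  obtain ⟨hs₀, hs₁⟩ := hs
  obtain ⟨ht₀, ht₁⟩ := ht
  have hd : 0 < s + 1 := by linarith
  unfold hcomp rightUnitor constHomotopy
  split_ifs with h h'
  · rw [le_div_iff₀' hd] at h'
    rw [min_eq_left h', max_eq_left (by linarith), add_zero]
    exact hα _ ⟨by positivity, h'⟩
  · rw [le_div_iff₀' hd] at h'
    rw [min_eq_right (by linarith), max_eq_left (by linarith), add_zero, hx₂]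
  · rw [min_eq_right (by nlinarith), max_eq_right (by linarith)]
    exact hβ _ ⟨by linarith, by linarith⟩

/-- The parameter on the concatenation `[0,2]` traced by the vertical composite of the left
unitor and the associator, written so that its continuity is manifest. -/
noncomputable def vcompParam (s t : ℝ) : ℝ :=
  unitorParam (min (2 * s) 1) t + associatorParam (max (2 * s - 1) 0) t - unitorParam 1 t

theorem associatorParam_zero (t : ℝ) : associatorParam 0 t = unitorParam 1 t := by
  unfold associatorParam unitorParam
  congr 2 <;> ring

theorem vcompParam_eq (s t : ℝ) :
    vcompParam s t = vcomp associatorParam unitorParam s t := by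
  unfold vcompParam vcomp
  split_ifs with h
  · rw [min_eq_left (by linarith), max_eq_right (by linarith), associatorParam_zero]
    ring
  · rw [min_eq_right (by linarith), max_eq_left (by linarith)]
    ring

theorem continuousOn_vcompParam :
    ContinuousOn (fun p : ℝ × ℝ => vcompParam p.1 p.2) (Icc 0 1 ×ˢ Icc 0 1) := by
  unfold vcompParam unitorParam associatorParam
  have h₁ : ∀ p ∈ Icc (0 : ℝ) 1 ×ˢ Icc (0 : ℝ) 1, 2 - min (2 * p.1) 1 ≠ 0 := fun p _ => by
    linarith [min_le_right (2 * p.1) 1]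
  have h₂ : ∀ p ∈ Icc (0 : ℝ) 1 ×ˢ Icc (0 : ℝ) 1, 2 - max (2 * p.1 - 1) 0 ≠ 0 := fun p hp => by
    have : max (2 * p.1 - 1) 0 ≤ 1 := max_le (by linarith [hp.1.2]) zero_le_one
    linarith
  have h₃ : ∀ p ∈ Icc (0 : ℝ) 1 ×ˢ Icc (0 : ℝ) 1, 1 + max (2 * p.1 - 1) 0 ≠ 0 := fun p _ => by
    linarith [le_max_right (2 * p.1 - 1) 0]
  fun_prop (disch := first | assumption | norm_num)

theorem vcompParam_spec {Y : Type*} {x₂ : Y} {α β γ : ℝ → Y}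
    (hα : ∀ u ∈ Icc (0 : ℝ) 1, γ u = α u) (hβ : ∀ u ∈ Icc (0 : ℝ) 1, γ (1 + u) = β u)
    (hx₂ : γ 1 = x₂) {s t : ℝ} (hs : s ∈ Icc (0 : ℝ) 1) (ht : t ∈ Icc (0 : ℝ) 1) :
    γ (vcompParam s t) = vcomp (associator β (constPath x₂) α)
      (hcomp (leftUnitor x₂ β) (constHomotopy α)) s t := by
  rw [vcompParam_eq]
  unfold vcomp
  split_ifs with h
  · exact unitorParam_spec hα hβ hx₂ ⟨by linarith [hs.1], by linarith⟩ ht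
  · exact associatorParam_spec hα hβ hx₂ ⟨by linarith, by linarith [hs.2]⟩ ht

/-- the triangle (identity coherence) for the homotopy bigroupoid:
`[ā(β, 1_{x₂}, α)] ⬝ [L(β) ∘ c_α] = [c_β ∘ R(α)]` as 2-tracks from `β ∘ α` to
`β ∘ (1_{x₂} ∘ α)`. -/
theorem triangle (x₁ x₂ x₃ : X) (α β : ℝ → X)
    (hα : IsPath x₁ x₂ α) (hβ : IsPath x₂ x₃ β) :
    HomotopyEquiv x₁ x₃ (pathComp β α) (pathComp β (pathComp (constPath x₂) α))
      (vcomp (associator β (constPath x₂) α)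
        (hcomp (leftUnitor x₂ β) (constHomotopy α)))
      (hcomp (constHomotopy β) (rightUnitor x₂ α)) := by
  obtain ⟨γ, hγ, hγα, hγβ⟩ := exists_continuous_concat hα hβ
  have h01 : (0 : ℝ) ∈ Icc (0 : ℝ) 1 := ⟨le_rfl, zero_le_one⟩
  have h11 : (1 : ℝ) ∈ Icc (0 : ℝ) 1 := ⟨zero_le_one, le_rfl⟩
  have hx₂ : γ 1 = x₂ := (hγα 1 h11).trans hα.2.2
  have hR : ∀ s ∈ Icc (0 : ℝ) 1, ∀ t ∈ Icc (0 : ℝ) 1,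
      γ (min ((s + 1) * (2 * t)) 1 + max 0 (2 * t - 1)) =
        hcomp (constHomotopy β) (rightUnitor x₂ α) s t :=
    fun s hs t ht => rightUnitorParam_spec hγα hγβ hx₂ hs ht
  refine HomotopyEquiv.of_reparam hγ (a := 0) (b := 1 + 1)
    (g := fun s t => min ((s + 1) * (2 * t)) 1 + max 0 (2 * t - 1))
    continuousOn_vcompParam (by fun_prop)
    (fun s hs t ht => vcompParam_spec hγα hγβ hx₂ hs ht) hR ?_ ?_ ?_ ?_ ?_ ?_ ?_ ?_
    ((hγα 0 h01).trans hα.2.1) ((hγβ 1 h11).trans hβ.2.2)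
  · intro t _
    have : (2 * (2 * t - 1) - 2 * 0) / (2 - 2 * 0) = 2 * t - 1 := by ring
    rw [vcompParam_eq, vcomp, if_pos (by norm_num), unitorParam, this, zero_add, one_mul]
  · intro t _
    have h₁ : 4 * t / (2 - (2 * 1 - 1)) = (1 + 1) * (2 * t) := by ring
    have h₂ : (4 * t - 3 + (2 * 1 - 1)) / (1 + (2 * 1 - 1)) = 2 * t - 1 := by ring
    rw [vcompParam_eq, vcomp, if_neg (by norm_num), associatorParam, h₁, h₂]
  · intro t ht
    refine (hR 0 h01 t ht).trans ?_
    unfold hcomp pathComp rightUnitor constHomotopy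
    split_ifs with h h'
    · rw [zero_add, one_mul]
    · exact absurd (by norm_num; linarith) h'
    · rfl
  · intro t ht
    refine (hR 1 h11 t ht).trans ?_
    unfold hcomp pathComp rightUnitor constHomotopy constPath
    norm_num
  · rintro s ⟨hs₀, hs₁⟩
    rw [vcompParam_eq]
    unfold vcomp unitorParam associatorParam
    split_ifs with h
    · rw [max_eq_left (div_nonpos_of_nonpos_of_nonneg (by linarith) (by linarith))]
      norm_num
    · rw [max_eq_left (div_nonpos_of_nonpos_of_nonneg (by linarith) (by linarith))]
      norm_num
  · intro s _
    norm_num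
  · rintro s ⟨hs₀, hs₁⟩
    rw [vcompParam_eq]
    unfold vcomp unitorParam associatorParam
    split_ifs with h
    · rw [show 2 * (2 * 1 - 1) - 2 * s = 2 - 2 * s by ring, div_self (by linarith)]
      norm_num
    · rw [min_eq_right ((one_le_div (by linarith)).2 (by linarith)),
        show 4 * 1 - 3 + (2 * s - 1) = 1 + (2 * s - 1) by ring, div_self (by linarith)]
      norm_num
  · rintro s ⟨hs₀, _⟩
    rw [min_eq_right (by linarith)]
    norm_num

end BundleTwoGerbe
end
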